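/- arXiv:quant-ph/0505063 — 3 statements merged into one kernel-verified Lean document; each statement's English description precedes it below -/
import Mathlib

section
/- Let L be a Lie ring and let x, y ∈ L. For every natural number k, ⁅ad_x^{k+1}(y), ad_x^{k}(y)⁆ = Σ_{j=0}^{k} ((−1)^j · binomial(k, j)) • ad_x^{k−j}( ⁅ad_x^{k+j+1}(y), y⁆ ), where the coefficient (−1)^j·binomial(k,j) acts by integer scalar multiplication. -/
/-- Moving iterates of `ad x` from the right to the left argument of the bracket. -/
theorem lie_iterate_lie_right {L : Type*} [LieRing L] (x a y : L) (k : ℕ) :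
    ⁅a, (fun w => ⁅x, w⁆)^[k] y⁆ =
      ∑ j ∈ Finset.range (k + 1),
        ((-1 : ℤ) ^ j * (k.choose j : ℤ)) •
          (fun w => ⁅x, w⁆)^[k - j] ⁅(fun w => ⁅x, w⁆)^[j] a, y⁆ := by
  let D : Module.End ℤ L := LieAlgebra.ad ℤ L x
  let B : L → Module.End ℤ L := fun y => -LieAlgebra.ad ℤ L y
  have hD (n : ℕ) (w : L) : (fun w => ⁅x, w⁆)^[n] w = (D ^ n) w :=
    (Module.End.pow_apply D n w).symm
  have hB (w a : L) : ⁅a, w⁆ = B w a := (lie_skew a w).symm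
  let T := -LinearMap.mulRight ℤ D + LinearMap.mulLeft ℤ D
  have hT (n : ℕ) : B ((D ^ n) y) = (T ^ n) (B y) := by
    induction n with
    | zero => simp
    | succ n ih =>
      rw [pow_succ', pow_succ', Module.End.mul_apply, Module.End.mul_apply, ← ih]
      ext a
      generalize (D ^ n) y = w
      have h := lie_lie x w a
      simp only [T, D, B, LinearMap.add_apply, LinearMap.neg_apply, LinearMap.mulRight_apply,
        LinearMap.mulLeft_apply, Module.End.mul_apply, LieAlgebra.ad_apply, lie_neg, h]
      abel
  have hcomm : Commute (-LinearMap.mulRight ℤ D) (LinearMap.mulLeft ℤ D) :=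
    (LinearMap.commute_mulLeft_right D D).symm.neg_left
  simp only [hD]
  rw [hB, hT, hcomm.add_pow, LinearMap.sum_apply, LinearMap.sum_apply]
  refine Finset.sum_congr rfl fun j _ => ?_
  rw [neg_pow, hB, ← nsmul_eq_mul', mul_smul, LinearMap.pow_mulLeft, LinearMap.pow_mulRight]
  rcases Nat.even_or_odd j with h | h <;> simp [h.neg_one_pow, mul_assoc]

/-- Kunita's identity, used in the inductive step of Theorem 4: in any Lie ring,
`⁅ad_x^{k+1} y, ad_x^k y⁆ = ∑_{j=0}^{k} (−1)^j C(k,j) • ad_x^{k−j} ⁅ad_x^{k+j+1} y, y⁆`. -/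
theorem kunita_bracket_identity {L : Type*} [LieRing L] (x y : L) (k : ℕ) :
    ⁅(fun w => ⁅x, w⁆)^[k + 1] y, (fun w => ⁅x, w⁆)^[k] y⁆ =
      ∑ j ∈ Finset.range (k + 1),
        ((-1 : ℤ) ^ j * (k.choose j : ℤ)) •
          (fun w => ⁅x, w⁆)^[k - j] ⁅(fun w => ⁅x, w⁆)^[k + j + 1] y, y⁆ := by
  rw [lie_iterate_lie_right]
  refine Finset.sum_congr rfl fun j _ => ?_
  rw [← Function.iterate_add_apply, show j + (k + 1) = k + j + 1 by omega]
end

section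
/- Let L be a Lie algebra over ℂ and let x, y, z ∈ L satisfy ⁅x,y⁆ = z, ⁅y,z⁆ = x, ⁅z,x⁆ = −y, with ι : L → U(L) the canonical map into the universal enveloping algebra. For all natural numbers p, q, r with n = p + q + r, the element ⁅(ι x)^p (ι y)^q (ι z)^r, ι x⁆ + q • (ι x)^p (ι y)^{q−1} (ι z)^{r+1} + r • (ι x)^p (ι y)^{q+1} (ι z)^{r−1} lies in the ℂ-linear span of the ordered monomials { (ι x)^a (ι y)^b (ι z)^c : a + b + c ≤ n − 1 } (when q = 0 or r = 0 the corresponding term carries coefficient 0 and so vanishes). -/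
section OrderedMonomials

variable {R A : Type*} [CommRing R] [Ring A] [Algebra R A]

/-- The span of the unit and three elements of an algebra. -/
def unitTripleSpan (R : Type*) {A : Type*} [CommRing R] [Ring A] [Algebra R A] (X Y Z : A) :
    Submodule R A :=
  Submodule.span R {1, X, Y, Z}

/-- The span of the ordered monomials in three elements of order at most `n`. -/
def orderedMonomialSpan (R : Type*) {A : Type*} [CommRing R] [Ring A] [Algebra R A] (X Y Z : A)
    (n : ℕ) : Submodule R A :=
  Submodule.span R {u : A | ∃ a b c : ℕ, a + b + c ≤ n ∧ u = X ^ a * Y ^ b * Z ^ c}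

variable {X Y Z : A}

lemma one_mem_unitTripleSpan : (1 : A) ∈ unitTripleSpan R X Y Z :=
  Submodule.subset_span (by simp)

lemma fst_mem_unitTripleSpan : X ∈ unitTripleSpan R X Y Z :=
  Submodule.subset_span (by simp)

lemma snd_mem_unitTripleSpan : Y ∈ unitTripleSpan R X Y Z :=
  Submodule.subset_span (by simp)

lemma thd_mem_unitTripleSpan : Z ∈ unitTripleSpan R X Y Z :=
  Submodule.subset_span (by simp)

lemma unitTripleSpan_pow_mono {m n : ℕ} (h : m ≤ n) :
    unitTripleSpan R X Y Z ^ m ≤ unitTripleSpan R X Y Z ^ n :=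
  pow_le_pow_right₀ (Submodule.one_le.mpr one_mem_unitTripleSpan) h

lemma mul_mem_pow_of_add_eq {V : Submodule R A} {u v : A} {m n k : ℕ} (hu : u ∈ V ^ m)
    (hv : v ∈ V ^ n) (h : m + n = k) : u * v ∈ V ^ k := by
  rw [← h, pow_add]
  exact Submodule.mul_mem_mul hu hv

lemma monomial_mem_orderedMonomialSpan {a b c n : ℕ} (h : a + b + c ≤ n) :
    X ^ a * Y ^ b * Z ^ c ∈ orderedMonomialSpan R X Y Z n :=
  Submodule.subset_span ⟨a, b, c, h, rfl⟩

lemma orderedMonomialSpan_mono {m n : ℕ} (h : m ≤ n) :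
    orderedMonomialSpan R X Y Z m ≤ orderedMonomialSpan R X Y Z n :=
  Submodule.span_mono fun _ ⟨a, b, c, habc, hu⟩ => ⟨a, b, c, habc.trans h, hu⟩

/-- If the commutator with `v` preserves `V`, then it preserves every power of `V`. -/
lemma commutator_mem_pow {V : Submodule R A} {v : A} (hv : ∀ u ∈ V, v * u - u * v ∈ V) (n : ℕ) :
    ∀ u ∈ V ^ n, v * u - u * v ∈ V ^ n := by
  induction n with
  | zero =>
    intro u hu
    obtain ⟨t, rfl⟩ := Submodule.mem_one.mp (by simpa using hu)
    simp [Algebra.commutes t v]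
  | succ n ih =>
    intro u hu
    rw [pow_succ] at hu
    induction hu using Submodule.mul_induction_on' with
    | mem_mul_mem s hs t ht =>
      have e : v * (s * t) - s * t * v = (v * s - s * v) * t + s * (v * t - t * v) := by
        noncomm_ring
      rw [e, pow_succ]
      exact add_mem (Submodule.mul_mem_mul (ih s hs) ht) (Submodule.mul_mem_mul hs (hv t ht))
    | add s _ t _ hs ht =>
      have e : v * (s + t) - (s + t) * v = (v * s - s * v) + (v * t - t * v) := by noncomm_ring
      rw [e]
      exact add_mem hs ht

lemma commutator_mem_unitTripleSpan {v : A} (hX : v * X - X * v ∈ unitTripleSpan R X Y Z)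
    (hY : v * Y - Y * v ∈ unitTripleSpan R X Y Z) (hZ : v * Z - Z * v ∈ unitTripleSpan R X Y Z) :
    ∀ u ∈ unitTripleSpan R X Y Z, v * u - u * v ∈ unitTripleSpan R X Y Z := by
  intro u hu
  induction hu using Submodule.span_induction with
  | mem u hu =>
    rcases hu with rfl | rfl | rfl | rfl
    · simp
    · exact hX
    · exact hY
    · exact hZ
  | zero => simp
  | add s t _ _ hs ht =>
    have e : v * (s + t) - (s + t) * v = (v * s - s * v) + (v * t - t * v) := by noncomm_ring
    rw [e]
    exact add_mem hs ht
  | smul r s _ hs =>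
    rw [mul_smul_comm, smul_mul_assoc, ← smul_sub]
    exact Submodule.smul_mem _ r hs

/-- The spanning half of the Poincaré–Birkhoff–Witt theorem, with control of the order. -/
lemma unitTripleSpan_pow_le_orderedMonomialSpan
    (hY : ∀ u ∈ unitTripleSpan R X Y Z, Y * u - u * Y ∈ unitTripleSpan R X Y Z)
    (hZ : ∀ u ∈ unitTripleSpan R X Y Z, Z * u - u * Z ∈ unitTripleSpan R X Y Z) (n : ℕ) :
    unitTripleSpan R X Y Z ^ n ≤ orderedMonomialSpan R X Y Z n := by
  induction n with
  | zero =>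
    rw [pow_zero, Submodule.one_le]
    simpa using monomial_mem_orderedMonomialSpan (R := R) (X := X) (Y := Y) (Z := Z)
      (a := 0) (b := 0) (c := 0) le_rfl
  | succ n ih =>
    rw [pow_succ']
    refine (mul_le_mul_right ih _).trans ?_
    unfold unitTripleSpan
    conv_lhs => rw [orderedMonomialSpan, Submodule.span_mul_span]
    rw [Submodule.span_le]
    rintro _ ⟨v, hv, _, ⟨a, b, c, h, rfl⟩, rfl⟩
    have hXa : X ^ a ∈ unitTripleSpan R X Y Z ^ a :=
      Submodule.pow_mem_pow _ fst_mem_unitTripleSpan a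
    have hYb : Y ^ b ∈ unitTripleSpan R X Y Z ^ b :=
      Submodule.pow_mem_pow _ snd_mem_unitTripleSpan b
    have hZc : Z ^ c ∈ unitTripleSpan R X Y Z ^ c :=
      Submodule.pow_mem_pow _ thd_mem_unitTripleSpan c
    have lower : ∀ u ∈ unitTripleSpan R X Y Z ^ (a + b + c),
        u ∈ orderedMonomialSpan R X Y Z (n + 1) := fun u hu =>
      orderedMonomialSpan_mono n.le_succ (ih (unitTripleSpan_pow_mono h hu))
    simp only [SetLike.mem_coe]
    rcases hv with rfl | rfl | rfl | rfl
    · simpa using monomial_mem_orderedMonomialSpan (R := R) (X := X) (Y := Y) (Z := Z)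
        (h.trans n.le_succ)
    · have e : v * (v ^ a * Y ^ b * Z ^ c) = v ^ (a + 1) * Y ^ b * Z ^ c := by
        simp only [pow_succ', mul_assoc]
      simp only [e]
      exact monomial_mem_orderedMonomialSpan (by omega)
    · have e : v * (X ^ a * v ^ b * Z ^ c) = X ^ a * v ^ (b + 1) * Z ^ c +
          (v * X ^ a - X ^ a * v) * v ^ b * Z ^ c := by
        rw [pow_succ']
        noncomm_ring
      simp only [e]
      refine add_mem (monomial_mem_orderedMonomialSpan (by omega)) (lower _ ?_)
      exact mul_mem_pow_of_add_eq
        (mul_mem_pow_of_add_eq (commutator_mem_pow hY a _ hXa) hYb rfl) hZc rfl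
    · have e : v * (X ^ a * Y ^ b * v ^ c) = X ^ a * Y ^ b * v ^ (c + 1) +
          (v * (X ^ a * Y ^ b) - X ^ a * Y ^ b * v) * v ^ c := by
        rw [pow_succ']
        noncomm_ring
      simp only [e]
      refine add_mem (monomial_mem_orderedMonomialSpan (by omega)) (lower _ ?_)
      exact mul_mem_pow_of_add_eq
        (commutator_mem_pow hZ _ _ (mul_mem_pow_of_add_eq hXa hYb rfl)) hZc rfl

lemma pow_snd_commutator_add_mem (hyx : Y * X = X * Y - Z) (hzy : Z * Y = Y * Z - X) (q : ℕ) :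
    Y ^ (q + 1) * X - X * Y ^ (q + 1) + (q + 1) • (Y ^ q * Z) ∈ unitTripleSpan R X Y Z ^ q := by
  induction q with
  | zero => simp [hyx]
  | succ q ih =>
    have e : Y ^ (q + 1 + 1) * X - X * Y ^ (q + 1 + 1) + (q + 1 + 1) • (Y ^ (q + 1) * Z) =
        (Y ^ (q + 1) * X - X * Y ^ (q + 1) + (q + 1) • (Y ^ q * Z)) * Y +
          (q + 1) • (Y ^ q * X) := by
      have e₁ : Y ^ (q + 1 + 1) * X = Y ^ (q + 1) * X * Y - Y ^ (q + 1) * Z := by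
        rw [pow_succ Y (q + 1), mul_assoc, hyx]
        noncomm_ring
      have e₂ : Y ^ q * Z * Y = Y ^ (q + 1) * Z - Y ^ q * X := by
        rw [mul_assoc, hzy, pow_succ]
        noncomm_ring
      rw [e₁, add_mul, sub_mul, smul_mul_assoc, e₂, succ_nsmul _ (q + 1), smul_sub,
        pow_succ Y (q + 1), ← mul_assoc X]
      abel
    rw [e]
    have hYq : Y ^ q ∈ unitTripleSpan R X Y Z ^ q :=
      Submodule.pow_mem_pow _ snd_mem_unitTripleSpan q
    refine add_mem ?_ (Submodule.smul_of_tower_mem _ _ ?_) <;> rw [pow_succ]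
    · exact Submodule.mul_mem_mul ih snd_mem_unitTripleSpan
    · exact Submodule.mul_mem_mul hYq fst_mem_unitTripleSpan

lemma pow_thd_commutator_add_mem (hzx : Z * X = X * Z - Y) (hzy : Z * Y = Y * Z - X) (r : ℕ) :
    Z ^ (r + 1) * X - X * Z ^ (r + 1) + (r + 1) • (Y * Z ^ r) ∈ unitTripleSpan R X Y Z ^ r := by
  induction r with
  | zero => simp [hzx]
  | succ r ih =>
    have e : Z ^ (r + 1 + 1) * X - X * Z ^ (r + 1 + 1) + (r + 1 + 1) • (Y * Z ^ (r + 1)) =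
        Z * (Z ^ (r + 1) * X - X * Z ^ (r + 1) + (r + 1) • (Y * Z ^ r)) +
          (r + 1) • (X * Z ^ r) := by
      have e₁ : Z * (X * Z ^ (r + 1)) = X * Z ^ (r + 1 + 1) - Y * Z ^ (r + 1) := by
        rw [← mul_assoc, hzx, pow_succ' Z (r + 1)]
        noncomm_ring
      have e₂ : Z * (Y * Z ^ r) = Y * Z ^ (r + 1) - X * Z ^ r := by
        rw [← mul_assoc, hzy, pow_succ']
        noncomm_ring
      rw [mul_add, mul_sub, mul_smul_comm, e₁, e₂, succ_nsmul _ (r + 1), smul_sub,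
        ← mul_assoc Z, ← pow_succ']
      abel
    rw [e]
    have hZr : Z ^ r ∈ unitTripleSpan R X Y Z ^ r :=
      Submodule.pow_mem_pow _ thd_mem_unitTripleSpan r
    refine add_mem ?_ (Submodule.smul_of_tower_mem _ _ ?_) <;> rw [pow_succ']
    · exact Submodule.mul_mem_mul thd_mem_unitTripleSpan ih
    · exact Submodule.mul_mem_mul fst_mem_unitTripleSpan hZr

lemma commutator_monomial_add_mem (hyx : Y * X = X * Y - Z) (hzy : Z * Y = Y * Z - X)
    (hzx : Z * X = X * Z - Y) (p q r : ℕ) :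
    X ^ p * Y ^ q * Z ^ r * X - X * (X ^ p * Y ^ q * Z ^ r) +
        q • (X ^ p * Y ^ (q - 1) * Z ^ (r + 1)) + r • (X ^ p * Y ^ (q + 1) * Z ^ (r - 1)) ∈
      unitTripleSpan R X Y Z ^ (p + q + r - 1) := by
  have e : X ^ p * Y ^ q * Z ^ r * X - X * (X ^ p * Y ^ q * Z ^ r) +
        q • (X ^ p * Y ^ (q - 1) * Z ^ (r + 1)) + r • (X ^ p * Y ^ (q + 1) * Z ^ (r - 1)) =
      X ^ p * (Y ^ q * X - X * Y ^ q + q • (Y ^ (q - 1) * Z)) * Z ^ r +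
        X ^ p * Y ^ q * (Z ^ r * X - X * Z ^ r + r • (Y * Z ^ (r - 1))) := by
    have hX : X * (X ^ p * Y ^ q * Z ^ r) = X ^ p * X * Y ^ q * Z ^ r := by
      simp only [← mul_assoc, ← pow_succ, ← pow_succ']
    rw [hX, pow_succ' Z r, pow_succ Y q]
    simp only [mul_add, add_mul, mul_sub, sub_mul, mul_smul_comm, smul_mul_assoc, mul_assoc]
    abel
  have hXp : X ^ p ∈ unitTripleSpan R X Y Z ^ p :=
    Submodule.pow_mem_pow _ fst_mem_unitTripleSpan p
  have hYq : Y ^ q ∈ unitTripleSpan R X Y Z ^ q :=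
    Submodule.pow_mem_pow _ snd_mem_unitTripleSpan q
  have hZr : Z ^ r ∈ unitTripleSpan R X Y Z ^ r :=
    Submodule.pow_mem_pow _ thd_mem_unitTripleSpan r
  rw [e]
  refine add_mem ?_ ?_
  · cases q with
    | zero => simp
    | succ q =>
      exact mul_mem_pow_of_add_eq (mul_mem_pow_of_add_eq hXp
        (pow_snd_commutator_add_mem hyx hzy q) rfl) hZr (by omega)
  · cases r with
    | zero => simp
    | succ r =>
      exact mul_mem_pow_of_add_eq (mul_mem_pow_of_add_eq hXp hYq rfl)
        (pow_thd_commutator_add_mem hzx hzy r) (by omega)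

end OrderedMonomials

namespace UniversalEnvelopingAlgebra

attribute [local instance] LieRing.ofAssociativeRing

variable (R : Type*) {L : Type*} [CommRing R] [LieRing L] [LieAlgebra R L]

lemma ι_lie (a b : L) : ι R ⁅a, b⁆ = ι R a * ι R b - ι R b * ι R a :=
  LieHom.map_lie (ι R) a b

lemma ι_neg (a : L) : ι R (-a) = -ι R a :=
  map_neg (ι R) a

end UniversalEnvelopingAlgebra

/-- Appendix B commutator formula: with `⁅x,y⁆ = z`, `⁅y,z⁆ = x`, `⁅z,x⁆ = −y` in the
scattering algebra `su(1,1)`,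
`⁅(ιx)^p (ιy)^q (ιz)^r, ιx⁆ = −q (ιx)^p (ιy)^{q−1} (ιz)^{r+1}
  − r (ιx)^p (ιy)^{q+1} (ιz)^{r−1} + Q_{n−1}`,
where `Q_{n−1}` is a linear combination of ordered monomials of order `≤ n − 1`. -/
theorem su11_enveloping_bracket_with_x_mod_lower_order
    {L : Type*} [LieRing L] [LieAlgebra ℂ L] (x y z : L)
    (hxy : ⁅x, y⁆ = z) (hyz : ⁅y, z⁆ = x) (hzx : ⁅z, x⁆ = -y)
    (p q r : ℕ) :
    ⁅(UniversalEnvelopingAlgebra.ι ℂ x) ^ p * (UniversalEnvelopingAlgebra.ι ℂ y) ^ q *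
        (UniversalEnvelopingAlgebra.ι ℂ z) ^ r, UniversalEnvelopingAlgebra.ι ℂ x⁆ +
      q • ((UniversalEnvelopingAlgebra.ι ℂ x) ^ p * (UniversalEnvelopingAlgebra.ι ℂ y) ^ (q - 1) *
        (UniversalEnvelopingAlgebra.ι ℂ z) ^ (r + 1)) +
      r • ((UniversalEnvelopingAlgebra.ι ℂ x) ^ p * (UniversalEnvelopingAlgebra.ι ℂ y) ^ (q + 1) *
        (UniversalEnvelopingAlgebra.ι ℂ z) ^ (r - 1)) ∈
      Submodule.span ℂ
        {u : UniversalEnvelopingAlgebra ℂ L | ∃ a b c : ℕ, a + b + c ≤ p + q + r - 1 ∧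
          u = (UniversalEnvelopingAlgebra.ι ℂ x) ^ a * (UniversalEnvelopingAlgebra.ι ℂ y) ^ b *
            (UniversalEnvelopingAlgebra.ι ℂ z) ^ c} := by
  have hyx' : UniversalEnvelopingAlgebra.ι ℂ y * UniversalEnvelopingAlgebra.ι ℂ x =
      UniversalEnvelopingAlgebra.ι ℂ x * UniversalEnvelopingAlgebra.ι ℂ y -
        UniversalEnvelopingAlgebra.ι ℂ z := by
    rw [← hxy, UniversalEnvelopingAlgebra.ι_lie]
    abel
  have hzy' : UniversalEnvelopingAlgebra.ι ℂ z * UniversalEnvelopingAlgebra.ι ℂ y =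
      UniversalEnvelopingAlgebra.ι ℂ y * UniversalEnvelopingAlgebra.ι ℂ z -
        UniversalEnvelopingAlgebra.ι ℂ x := by
    rw [← hyz, UniversalEnvelopingAlgebra.ι_lie]
    abel
  have hzx' : UniversalEnvelopingAlgebra.ι ℂ z * UniversalEnvelopingAlgebra.ι ℂ x =
      UniversalEnvelopingAlgebra.ι ℂ x * UniversalEnvelopingAlgebra.ι ℂ z -
        UniversalEnvelopingAlgebra.ι ℂ y := by
    rw [← neg_neg y, ← hzx, UniversalEnvelopingAlgebra.ι_neg, UniversalEnvelopingAlgebra.ι_lie]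
    abel
  rw [LieRing.of_associative_ring_bracket]
  refine unitTripleSpan_pow_le_orderedMonomialSpan ?_ ?_ _
    (commutator_monomial_add_mem hyx' hzy' hzx' p q r)
  · refine commutator_mem_unitTripleSpan ?_ ?_ ?_
    · rw [hyx', sub_sub_cancel_left]
      exact neg_mem thd_mem_unitTripleSpan
    · simp
    · rw [hzy', sub_sub_cancel]
      exact fst_mem_unitTripleSpan
  · refine commutator_mem_unitTripleSpan ?_ ?_ ?_
    · rw [hzx', sub_sub_cancel_left]
      exact neg_mem snd_mem_unitTripleSpan
    · rw [hzy', sub_sub_cancel_left]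
      exact neg_mem fst_mem_unitTripleSpan
    · simp
end

section
/- Let L be a Lie algebra over ℂ and let x, y, z ∈ L satisfy ⁅x,y⁆ = z, ⁅y,z⁆ = x, ⁅z,x⁆ = −y, with ι : L → U(L) the canonical map into the universal enveloping algebra. Then for every natural number n ≥ 2, ⁅(ι x)², (ι x)^{n−2}·(ι y)⁆ = 2 • (ι x)^{n−1}·(ι z) − (ι x)^{n−2}·(ι y). -/
/-- In an associative ring, if `⁅a, b⁆ = c` and `⁅c, a⁆ = -b`, then
`⁅a ^ 2, a ^ k * b⁆ = 2 • (a ^ (k + 1) * c) - a ^ k * b`. -/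
theorem lie_sq_pow_mul_of_lie_eq {A : Type*} [Ring A] {a b c : A}
    (hab : ⁅a, b⁆ = c) (hca : ⁅c, a⁆ = -b) (k : ℕ) :
    ⁅a ^ 2, a ^ k * b⁆ = 2 • (a ^ (k + 1) * c) - a ^ k * b := by
  have hsq : a ^ 2 * b - b * a ^ 2 = 2 • (a * c) - b := by
    rw [Ring.lie_def] at hab hca
    calc a ^ 2 * b - b * a ^ 2 = a * (a * b - b * a) + (a * b - b * a) * a := by noncomm_ring
      _ = 2 • (a * c) + (c * a - a * c) := by rw [hab]; noncomm_ring
      _ = 2 • (a * c) - b := by rw [hca, sub_eq_add_neg]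
  calc ⁅a ^ 2, a ^ k * b⁆ = a ^ k * (a ^ 2 * b - b * a ^ 2) := by
        rw [Ring.lie_def, ← mul_assoc, ← pow_add, add_comm 2 k, pow_add, mul_sub, mul_assoc,
          mul_assoc]
    _ = 2 • (a ^ (k + 1) * c) - a ^ k * b := by
        rw [hsq, mul_sub, mul_smul_comm, ← mul_assoc, ← pow_succ]

/-- Appendix B base-step identity: with `⁅x,y⁆ = z`, `⁅y,z⁆ = x`, `⁅z,x⁆ = −y` in the
scattering algebra `su(1,1)`, for `n ≥ 2` one has
`⁅(ιx)², (ιx)^{n−2}·(ιy)⁆ = 2·(ιx)^{n−1}·(ιz) − (ιx)^{n−2}·(ιy)`. -/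
theorem su11_enveloping_base_step
    {L : Type*} [LieRing L] [LieAlgebra ℂ L] (x y z : L)
    (hxy : ⁅x, y⁆ = z) (hyz : ⁅y, z⁆ = x) (hzx : ⁅z, x⁆ = -y)
    (n : ℕ) (hn : 2 ≤ n) :
    ⁅(UniversalEnvelopingAlgebra.ι ℂ x) ^ 2,
        (UniversalEnvelopingAlgebra.ι ℂ x) ^ (n - 2) * UniversalEnvelopingAlgebra.ι ℂ y⁆ =
      2 • ((UniversalEnvelopingAlgebra.ι ℂ x) ^ (n - 1) * UniversalEnvelopingAlgebra.ι ℂ z) -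
        (UniversalEnvelopingAlgebra.ι ℂ x) ^ (n - 2) * UniversalEnvelopingAlgebra.ι ℂ y := by
  obtain ⟨k, rfl⟩ := Nat.exists_eq_add_of_le' hn
  let _ : LieRing (UniversalEnvelopingAlgebra ℂ L) := LieRing.ofAssociativeRing
  have hι : ∀ u v : L, ⁅UniversalEnvelopingAlgebra.ι ℂ u, UniversalEnvelopingAlgebra.ι ℂ v⁆ =
      UniversalEnvelopingAlgebra.ι ℂ ⁅u, v⁆ :=
    fun u v => ((UniversalEnvelopingAlgebra.ι ℂ).map_lie u v).symm
  exact lie_sq_pow_mul_of_lie_eq (by rw [hι, hxy]) (by rw [hι, hzx, map_neg]) k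
end
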